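/- Let n = 2m ≥ 2 and k, l ≥ 0 be integers with l + k even. For every (k,l)-Brauer partition β, the linear map F_β : (ℝⁿ)^{⊗k} → (ℝⁿ)^{⊗l} is Sp(n)-equivariant. -/

import Mathlib

open Matrix

noncomputable section

/-- The matrix of `g^{⊗k}` in the standard basis of `(ℝⁿ)^{⊗k}`. -/
def tpowM {n : ℕ} (k : ℕ) (g : Matrix (Fin n) (Fin n) ℝ) :
    Matrix (Fin k → Fin n) (Fin k → Fin n) ℝ :=
  Matrix.of fun I J => ∏ r, g (I r) (J r)

/-- Equivariance for the set of matrices satisfying `P`. -/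
def IsGEquiv {n : ℕ} (k l : ℕ) (P : Matrix (Fin n) (Fin n) ℝ → Prop)
    (φ : ((Fin k → Fin n) → ℝ) →ₗ[ℝ] ((Fin l → Fin n) → ℝ)) : Prop :=
  ∀ g : Matrix (Fin n) (Fin n) ℝ, P g →
    φ ∘ₗ (tpowM k g).mulVecLin = (tpowM l g).mulVecLin ∘ₗ φ

/-- The matrix `Ω` of the standard skew-symmetric form in the symplectic basis:
block diagonal with `m` blocks `[[0, 1], [-1, 0]]`.  Its entries are the `ε_{i,j}`. -/
def OmegaM (n : ℕ) : Matrix (Fin n) (Fin n) ℝ :=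
  Matrix.of fun i j =>
    if (i : ℕ) % 2 = 0 ∧ (j : ℕ) = (i : ℕ) + 1 then 1
    else if (j : ℕ) % 2 = 0 ∧ (i : ℕ) = (j : ℕ) + 1 then -1 else 0

/-- A partition of `{1, …, N}` into disjoint pairs (a perfect matching),
encoded as a fixed-point-free involution: the blocks are the sets `{p, pair p}`. -/
structure BrauerPairing (N : ℕ) where
  pair : Fin N → Fin N
  invol : ∀ p, pair (pair p) = p
  ne : ∀ p, pair p ≠ p

/-- The matrix `F_β` of a `(k,l)`-Brauer partition `β` for the symplectic group:
the `(I,J)` entry is `∏_{{p,q} ∈ β, p < q} γ_{c_p, c_q}` where `c = I ⌢ J`, and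
`γ_{c_p,c_q}` is `δ_{c_p,c_q}` if `p, q` lie in different rows (exactly one of
them is `< l`), and `ε_{c_p,c_q}` if they lie in the same row. -/
def sympBrauerMatrix (n k l : ℕ) (β : BrauerPairing (l + k)) :
    Matrix (Fin l → Fin n) (Fin k → Fin n) ℝ :=
  Matrix.of fun I J =>
    ∏ p ∈ Finset.univ.filter (fun p => p < β.pair p),
      if ((p : ℕ) < l ↔ ((β.pair p : Fin (l + k)) : ℕ) < l) then
        OmegaM n (Fin.append I J p) (Fin.append I J (β.pair p))
      else if Fin.append I J p = Fin.append I J (β.pair p) then (1 : ℝ) else 0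

theorem OmegaM_sq (n m : ℕ) (hn : n = 2 * m) : OmegaM n * OmegaM n = -1 := by
  subst hn
  ext i j
  rw [Matrix.mul_apply]
  obtain ⟨i, hi⟩ := i
  by_cases h : i % 2 = 0
  · have h1 : i + 1 < 2 * m := by omega
    rw [Finset.sum_eq_single (⟨i + 1, h1⟩ : Fin (2 * m))]
    · simp only [OmegaM, Matrix.of_apply, Matrix.neg_apply, Matrix.one_apply, Fin.ext_iff]
      split_ifs <;> first | omega | (norm_num; done) | simp_all
    · intro b _ hb
      simp only [ne_eq, Fin.ext_iff] at hb
      simp only [OmegaM, Matrix.of_apply]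
      split_ifs <;> first | omega | (norm_num; done) | simp_all
    · simp
  · have h1 : i - 1 < 2 * m := by omega
    rw [Finset.sum_eq_single (⟨i - 1, h1⟩ : Fin (2 * m))]
    · simp only [OmegaM, Matrix.of_apply, Matrix.neg_apply, Matrix.one_apply, Fin.ext_iff]
      split_ifs <;> first | omega | (norm_num; done) | simp_all
    · intro b _ hb
      simp only [ne_eq, Fin.ext_iff] at hb
      simp only [OmegaM, Matrix.of_apply]
      split_ifs <;> first | omega | (norm_num; done) | simp_all
    · simp

theorem sp_transpose (n m : ℕ) (hn : n = 2 * m) (g : Matrix (Fin n) (Fin n) ℝ)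
    (hg : gᵀ * OmegaM n * g = OmegaM n) : g * OmegaM n * gᵀ = OmegaM n := by
  have h2 := OmegaM_sq n m hn
  have h3 : (-(OmegaM n * gᵀ * OmegaM n)) * g = 1 := by
    rw [neg_mul, mul_assoc, mul_assoc, ← mul_assoc gᵀ, hg, h2, neg_neg]
  have h4 := mul_eq_one_comm.mp h3
  have h5 : g * OmegaM n * gᵀ * (OmegaM n * OmegaM n) = - OmegaM n := by
    have : g * (OmegaM n * gᵀ * OmegaM n) = -1 := by
      rw [mul_neg] at h4
      rw [← h4, neg_neg]
    calc _ = g * (OmegaM n * gᵀ * OmegaM n) * OmegaM n := by simp only [mul_assoc]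
      _ = _ := by rw [this]; simp
  rw [h2] at h5
  simpa using h5

theorem tpowM_one {n : ℕ} (k : ℕ) : tpowM k (1 : Matrix (Fin n) (Fin n) ℝ) = 1 := by
  ext I J
  simp only [tpowM, Matrix.of_apply, Matrix.one_apply]
  by_cases h : I = J
  · simp [h]
  · rw [if_neg h]
    obtain ⟨t, ht⟩ := Function.ne_iff.mp h
    exact Finset.prod_eq_zero (Finset.mem_univ t) (if_neg ht)

theorem prod_pairing {N : ℕ} (β : BrauerPairing N) (f : Fin N → ℝ) :
    ∏ p, f p = ∏ p ∈ Finset.univ.filter (fun p => p < β.pair p), f p * f (β.pair p) := by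
  rw [Finset.prod_mul_distrib,
    ← Finset.prod_filter_mul_prod_filter_not Finset.univ (fun p => p < β.pair p)]
  congr 1
  refine Finset.prod_bij' (fun p _ => β.pair p) (fun p _ => β.pair p) ?_ ?_ ?_ ?_ ?_
  · intro p hp
    simp only [Finset.mem_filter, Finset.mem_univ, true_and, not_lt, β.invol] at hp ⊢
    exact lt_of_le_of_ne hp (β.ne p)
  · intro p hp
    simp only [Finset.mem_filter, Finset.mem_univ, true_and, not_lt, β.invol] at hp ⊢
    exact hp.le
  · intro p _; exact β.invol p
  · intro p _; exact β.invol p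
  · intro p _; simp only [β.invol]

/-- Colourings of vertices correspond to colourings of the pairs. -/
def pairEquiv {N n : ℕ} (β : BrauerPairing N) :
    (Fin N → Fin n) ≃ ({p : Fin N // p < β.pair p} → Fin n × Fin n) where
  toFun c s := (c s, c (β.pair s))
  invFun d p := if h : p < β.pair p then (d ⟨p, h⟩).1 else
    (d ⟨β.pair p, by
      rw [β.invol]; exact lt_of_le_of_ne (not_lt.mp h) (β.ne p)⟩).2
  left_inv c := by
    funext p
    by_cases h : p < β.pair p
    · simp [h]
    · simp [h, β.invol]
  right_inv d := by
    funext s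
    obtain ⟨s, hs⟩ := s
    have h : ¬ β.pair s < s := not_lt.mpr hs.le
    ext
    · simp [hs]
    · simp [β.invol, h]

theorem sum_pairing {N n : ℕ} (β : BrauerPairing N) (A : Fin N → Fin n → ℝ)
    (W : Fin N → Fin n → Fin n → ℝ) :
    ∑ c : Fin N → Fin n, (∏ p, A p (c p)) *
      ∏ p ∈ Finset.univ.filter (fun p => p < β.pair p), W p (c p) (c (β.pair p))
    = ∏ p ∈ Finset.univ.filter (fun p => p < β.pair p),
        ∑ x : Fin n × Fin n, A p x.1 * A (β.pair p) x.2 * W p x.1 x.2 := by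
  rw [Finset.prod_subtype (p := fun p => p < β.pair p) _ (by simp), Fintype.prod_sum]
  refine Fintype.sum_equiv (pairEquiv β) _ _ fun c => ?_
  rw [prod_pairing β, ← Finset.prod_mul_distrib,
    Finset.prod_subtype (p := fun p => p < β.pair p) _ (by simp)]
  rfl

/-- The weight of a pair. -/
def pairW (n k l : ℕ) (β : BrauerPairing (l + k)) (p : Fin (l + k)) (a b : Fin n) : ℝ :=
  if ((p : ℕ) < l ↔ ((β.pair p : Fin (l + k)) : ℕ) < l) then OmegaM n a b
  else if a = b then (1 : ℝ) else 0

/-- Matrix multiplication, with the instance pinned to the one of `Matrix`. -/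
def mmul {a b c : Type} [Fintype b] (A : Matrix a b ℝ) (B : Matrix b c ℝ) : Matrix a c ℝ :=
  @HMul.hMul _ _ _ Matrix.instHMulOfFintypeOfMulOfAddCommMonoid A B

theorem triple_apply (n k l : ℕ) (β : BrauerPairing (l + k)) (A B : Matrix (Fin n) (Fin n) ℝ)
    (I : Fin l → Fin n) (J : Fin k → Fin n) :
    mmul (mmul (tpowM l A) (sympBrauerMatrix n k l β)) (tpowM k B) I J =
      ∏ p ∈ Finset.univ.filter (fun p => p < β.pair p),
        ∑ x : Fin n × Fin n,
          Fin.append (fun t a => A (I t) a) (fun r a => B a (J r)) p x.1 *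
          Fin.append (fun t a => A (I t) a) (fun r a => B a (J r)) (β.pair p) x.2 *
          pairW n k l β p x.1 x.2 := by
  rw [← sum_pairing, ← (Fin.appendEquiv l k).sum_comp, Fintype.sum_prod_type_right]
  simp only [mmul, Matrix.mul_apply, Finset.sum_mul]
  refine Finset.sum_congr rfl fun K _ => Finset.sum_congr rfl fun I' _ => ?_
  simp only [Fin.appendEquiv, Equiv.coe_fn_mk, Fin.prod_univ_add, Fin.append_left,
    Fin.append_right, tpowM, sympBrauerMatrix, Matrix.of_apply, pairW]
  exact mul_right_comm _ _ _

theorem stmt5 (n m k l : ℕ) (hm : 1 ≤ m) (hn : n = 2 * m) (heven : Even (l + k))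
    (β : BrauerPairing (l + k)) :
    IsGEquiv k l (fun g => gᵀ * OmegaM n * g = OmegaM n)
      (sympBrauerMatrix n k l β).mulVecLin := by
  intro g hg
  have hg' := sp_transpose n m hn g hg
  rw [← Matrix.mulVecLin_mul, ← Matrix.mulVecLin_mul]
  congr 1
  have e1 : mmul (sympBrauerMatrix n k l β) (tpowM k g) =
      mmul (mmul (tpowM l 1) (sympBrauerMatrix n k l β)) (tpowM k g) := by
    simp only [mmul, tpowM_one, Matrix.one_mul]
  have e2 : mmul (tpowM l g) (sympBrauerMatrix n k l β) =
      mmul (mmul (tpowM l g) (sympBrauerMatrix n k l β)) (tpowM k 1) := by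
    simp only [mmul, tpowM_one, Matrix.mul_one]
  change mmul (sympBrauerMatrix n k l β) (tpowM k g) = mmul (tpowM l g) (sympBrauerMatrix n k l β)
  rw [e1, e2]
  ext I J
  rw [triple_apply, triple_apply]
  refine Finset.prod_congr rfl fun p hp => ?_
  have hlt : p < β.pair p := (Finset.mem_filter.mp hp).2
  unfold pairW
  generalize β.pair p = q at hlt
  simp only [Fintype.sum_prod_type]
  have hT : ∀ i j, ∑ a, ∑ b, g i a * g j b * OmegaM n a b = OmegaM n i j := by
    intro i j
    conv_rhs => rw [← hg']
    simp only [Matrix.mul_apply, Finset.sum_mul, Matrix.transpose_apply]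
    rw [Finset.sum_comm]
    exact Finset.sum_congr rfl fun _ _ => Finset.sum_congr rfl fun _ _ => by ring
  have hB : ∀ i j, ∑ a, ∑ b, g a i * g b j * OmegaM n a b = OmegaM n i j := by
    intro i j
    conv_rhs => rw [← hg]
    simp only [Matrix.mul_apply, Finset.sum_mul, Matrix.transpose_apply]
    rw [Finset.sum_comm]
    exact Finset.sum_congr rfl fun _ _ => Finset.sum_congr rfl fun _ _ => by ring
  induction p using Fin.addCases with
  | left t =>
    induction q using Fin.addCases with
    | left s => simp [hT, Matrix.one_apply]
    | right s => simp [Matrix.one_apply]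
  | right t =>
    induction q using Fin.addCases with
    | left s =>
      exfalso
      have := s.2
      simp only [Fin.lt_def, Fin.val_natAdd, Fin.val_castAdd] at hlt
      omega
    | right s => simp [hB, Matrix.one_apply]
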